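/- Let k ≥ 2 and suppose τ > 0 satisfies τ·‖M‖²·(‖H‖²‖T_k‖² + 2‖X_k‖)·s(B^k)² < 2. Then the equation (λ − 1)‖y‖² + τ·⟨Mᵀ[λI − (Bᵀ)^k]⁻¹[(λ − 1)X_k + T_kᵀHᵀH T_k](λI − B^k)⁻¹M y, y⟩ = 0 has no solution with λ ∈ ℝ, λ ≠ 1, |λ| ≥ 1 and y ∈ ℂ^{n_σ}, y ≠ 0. Moreover, if ‖B‖ < 1, it suffices that τ < ((1 − ‖B‖)²/(‖H‖²‖M‖²)) · 2(1 − ‖B‖^k)² / ((1 − ‖B‖^k)² + 2(1 − k‖B‖^{k−1} + (k−1)‖B‖^k)). -/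

import Mathlib

open Matrix

variable {nu nσ nf : ℕ}

/-- Operator norm induced by the Euclidean norms. -/
noncomputable def opNorm {𝕜 : Type*} [RCLike 𝕜] {m n : ℕ} (A : Matrix (Fin m) (Fin n) 𝕜) : ℝ :=
  ‖LinearMap.toContinuousLinearMap (Matrix.toEuclideanLin A)‖

/-- `s(T) = sup_{z ∈ ℂ, |z| ≥ 1} ‖(I − T/z)⁻¹‖`. -/
noncomputable def sSB {n : ℕ} (T : Matrix (Fin n) (Fin n) ℂ) : ℝ :=
  sSup {r : ℝ | ∃ z : ℂ, 1 ≤ ‖z‖ ∧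
    r = opNorm ((1 : Matrix (Fin n) (Fin n) ℂ) - z⁻¹ • T)⁻¹}

/-- `T_k = I + B + ... + B^{k−1}`. -/
noncomputable def Tmat (B : Matrix (Fin nu) (Fin nu) ℝ) (k : ℕ) :
    Matrix (Fin nu) (Fin nu) ℝ :=
  ∑ j ∈ Finset.range k, B ^ j

/-- `U_k = Σ_{i+j=k−1} (Bᵀ)^i HᵀH B^j`. -/
noncomputable def Umat (B : Matrix (Fin nu) (Fin nu) ℝ) (H : Matrix (Fin nf) (Fin nu) ℝ)
    (k : ℕ) : Matrix (Fin nu) (Fin nu) ℝ :=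
  ∑ i ∈ Finset.range k, (Bᵀ) ^ i * (Hᵀ * H) * B ^ (k - 1 - i)

/-- `X_k = Σ_{l=1}^{k−1} U_l` (so `X₁ = 0`). -/
noncomputable def Xmat (B : Matrix (Fin nu) (Fin nu) ℝ) (H : Matrix (Fin nf) (Fin nu) ℝ)
    (k : ℕ) : Matrix (Fin nu) (Fin nu) ℝ :=
  ∑ l ∈ Finset.Ico 1 k, Umat B H l

section L2OperatorNorm

open scoped Matrix.Norms.L2Operator

theorem opNorm_nonneg {𝕜 : Type*} [RCLike 𝕜] {m n : ℕ} (A : Matrix (Fin m) (Fin n) 𝕜) :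
    0 ≤ opNorm A := norm_nonneg _

theorem norm_toLp_mulVec_le_opNorm {𝕜 : Type*} [RCLike 𝕜] {m n : ℕ}
    (A : Matrix (Fin m) (Fin n) 𝕜) (x : Fin n → 𝕜) :
    ‖WithLp.toLp 2 (A *ᵥ x)‖ ≤ opNorm A * ‖WithLp.toLp 2 x‖ :=
  Matrix.l2_opNorm_mulVec A (WithLp.toLp 2 x)

theorem opNorm_mul_le {𝕜 : Type*} [RCLike 𝕜] {l m n : ℕ} (A : Matrix (Fin l) (Fin m) 𝕜)
    (B : Matrix (Fin m) (Fin n) 𝕜) : opNorm (A * B) ≤ opNorm A * opNorm B :=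
  Matrix.l2_opNorm_mul A B

theorem opNorm_add_le {𝕜 : Type*} [RCLike 𝕜] {m n : ℕ} (A B : Matrix (Fin m) (Fin n) 𝕜) :
    opNorm (A + B) ≤ opNorm A + opNorm B := norm_add_le A B

theorem opNorm_smul {𝕜 : Type*} [RCLike 𝕜] {m n : ℕ} (c : 𝕜) (A : Matrix (Fin m) (Fin n) 𝕜) :
    opNorm (c • A) = ‖c‖ * opNorm A := norm_smul c A

theorem opNorm_sum_le {𝕜 ι : Type*} [RCLike 𝕜] {m n : ℕ} (s : Finset ι)
    (A : ι → Matrix (Fin m) (Fin n) 𝕜) : opNorm (∑ i ∈ s, A i) ≤ ∑ i ∈ s, opNorm (A i) :=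
  norm_sum_le s A

theorem opNorm_transpose {m n : ℕ} (A : Matrix (Fin m) (Fin n) ℝ) : opNorm Aᵀ = opNorm A := by
  rw [← Matrix.conjTranspose_eq_transpose_of_trivial]
  exact Matrix.l2_opNorm_conjTranspose A

theorem continuous_opNorm {𝕜 : Type*} [RCLike 𝕜] {m n : ℕ} :
    Continuous (opNorm : Matrix (Fin m) (Fin n) 𝕜 → ℝ) :=
  continuous_norm.comp (LinearMap.continuous_of_finiteDimensional
    (LinearMap.toContinuousLinearMap.toLinearMap ∘ₗ Matrix.toEuclideanLin.toLinearMap :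
      Matrix (Fin m) (Fin n) 𝕜 →ₗ[𝕜] _))

end L2OperatorNorm

theorem opNorm_le_of_forall {𝕜 : Type*} [RCLike 𝕜] {m n : ℕ} (A : Matrix (Fin m) (Fin n) 𝕜)
    {c : ℝ} (hc : 0 ≤ c)
    (h : ∀ x : Fin n → 𝕜, ‖WithLp.toLp 2 (A *ᵥ x)‖ ≤ c * ‖WithLp.toLp 2 x‖) : opNorm A ≤ c :=
  ContinuousLinearMap.opNorm_le_bound _ hc fun x => h x.ofLp

theorem opNorm_one_le {𝕜 : Type*} [RCLike 𝕜] {n : ℕ} :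
    opNorm (1 : Matrix (Fin n) (Fin n) 𝕜) ≤ 1 :=
  opNorm_le_of_forall _ zero_le_one fun x => by simp

theorem opNorm_pow_le {𝕜 : Type*} [RCLike 𝕜] {n : ℕ} (A : Matrix (Fin n) (Fin n) 𝕜) (j : ℕ) :
    opNorm (A ^ j) ≤ opNorm A ^ j := by
  induction j with
  | zero => simpa using opNorm_one_le
  | succ j ih =>
    rw [pow_succ, pow_succ]
    exact (opNorm_mul_le _ _).trans (mul_le_mul_of_nonneg_right ih (opNorm_nonneg _))

theorem norm_toLp_sq_eq_re_add_im {n : ℕ} (x : Fin n → ℂ) :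
    ‖WithLp.toLp 2 x‖ ^ 2 =
      ‖WithLp.toLp 2 fun i => (x i).re‖ ^ 2 + ‖WithLp.toLp 2 fun i => (x i).im‖ ^ 2 := by
  simp only [EuclideanSpace.norm_sq_eq, ← Finset.sum_add_distrib]
  refine Finset.sum_congr rfl fun i _ => ?_
  simp only [Real.norm_eq_abs, sq_abs]
  rw [Complex.sq_norm, Complex.normSq_apply]
  ring

theorem opNorm_map_ofReal_le {m n : ℕ} (A : Matrix (Fin m) (Fin n) ℝ) :
    opNorm (A.map Complex.ofReal) ≤ opNorm A := by
  refine opNorm_le_of_forall _ (opNorm_nonneg A) fun x => ?_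
  refine (sq_le_sq₀ (norm_nonneg _) (mul_nonneg (opNorm_nonneg A) (norm_nonneg _))).mp ?_
  have hre : (fun i => ((A.map Complex.ofReal *ᵥ x) i).re) = A *ᵥ fun i => (x i).re := by
    ext i; simp [Matrix.mulVec, dotProduct]
  have him : (fun i => ((A.map Complex.ofReal *ᵥ x) i).im) = A *ᵥ fun i => (x i).im := by
    ext i; simp [Matrix.mulVec, dotProduct]
  rw [mul_pow, norm_toLp_sq_eq_re_add_im, norm_toLp_sq_eq_re_add_im x, hre, him, mul_add,
    ← mul_pow, ← mul_pow]
  gcongr <;> exact norm_toLp_mulVec_le_opNorm _ _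

theorem star_dotProduct_self_eq_norm_sq {n : ℕ} (x : Fin n → ℂ) :
    star x ⬝ᵥ x = ((‖WithLp.toLp 2 x‖ ^ 2 : ℝ) : ℂ) := by
  rw [dotProduct_comm, ← EuclideanSpace.inner_toLp_toLp, inner_self_eq_norm_sq_to_K]
  simp

theorem abs_re_star_dotProduct_mulVec_le {n : ℕ} (A : Matrix (Fin n) (Fin n) ℂ) (w : Fin n → ℂ) :
    |(star w ⬝ᵥ (A *ᵥ w)).re| ≤ opNorm A * ‖WithLp.toLp 2 w‖ ^ 2 := by
  refine (Complex.abs_re_le_norm _).trans ?_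
  rw [dotProduct_comm, ← EuclideanSpace.inner_toLp_toLp]
  refine (norm_inner_le_norm _ _).trans ?_
  nlinarith [norm_toLp_mulVec_le_opNorm A w, norm_nonneg (WithLp.toLp 2 w)]

theorem star_dotProduct_conjTranspose_mul_mul_mulVec {m n : ℕ} (W : Matrix (Fin m) (Fin n) ℂ)
    (Q : Matrix (Fin m) (Fin m) ℂ) (y : Fin n → ℂ) :
    star y ⬝ᵥ ((Wᴴ * Q * W) *ᵥ y) = star (W *ᵥ y) ⬝ᵥ (Q *ᵥ (W *ᵥ y)) := by
  rw [Matrix.star_mulVec, ← Matrix.dotProduct_mulVec, Matrix.mulVec_mulVec, Matrix.mulVec_mulVec,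
    Matrix.mul_assoc]

theorem map_ofReal_pow {n : ℕ} (B : Matrix (Fin n) (Fin n) ℝ) (k : ℕ) :
    (B ^ k).map Complex.ofReal = B.map Complex.ofReal ^ k :=
  map_pow (Complex.ofRealHom.mapMatrix) B k

theorem map_ofReal_mul {l m n : ℕ} (A : Matrix (Fin l) (Fin m) ℝ) (B : Matrix (Fin m) (Fin n) ℝ) :
    (A * B).map Complex.ofReal = A.map Complex.ofReal * B.map Complex.ofReal :=
  Matrix.map_mul (f := Complex.ofRealHom)

theorem map_ofReal_transpose {m n : ℕ} (A : Matrix (Fin m) (Fin n) ℝ) :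
    Aᵀ.map Complex.ofReal = (A.map Complex.ofReal)ᴴ := by
  ext i j; simp

/-- A matrix whose spectrum lies in the open unit disc has an invertible resolvent factor
`1 - u T^k` for every `u` in the closed unit disc. -/
theorem isUnit_det_one_sub_smul_pow {n : ℕ} {T : Matrix (Fin n) (Fin n) ℂ}
    (hT : ∀ μ ∈ spectrum ℂ T, ‖μ‖ < 1) {k : ℕ} (hk : 0 < k) {u : ℂ} (hu : ‖u‖ ≤ 1) :
    IsUnit ((1 : Matrix (Fin n) (Fin n) ℂ) - u • T ^ k).det := by
  rw [← Matrix.isUnit_iff_isUnit_det]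
  rcases eq_or_ne u 0 with rfl | hu0
  · simp
  have hmem : u⁻¹ ∉ spectrum ℂ (T ^ k) := by
    rw [spectrum.map_pow_of_pos T hk]
    rintro ⟨μ, hμ, hμk⟩
    have h1 : ‖μ‖ ^ k < 1 := pow_lt_one₀ (norm_nonneg _) (hT μ hμ) hk.ne'
    have h2 : ‖μ‖ ^ k = ‖u‖⁻¹ := by rw [← norm_pow, ← norm_inv]; exact congrArg norm hμk
    have h3 : 1 ≤ ‖u‖⁻¹ := (one_le_inv₀ (norm_pos_iff.mpr hu0)).mpr hu
    linarith
  rw [spectrum.notMem_iff, Algebra.algebraMap_eq_smul_one] at hmem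
  have : (1 : Matrix (Fin n) (Fin n) ℂ) - u • T ^ k = (Units.mk0 u hu0) • (u⁻¹ • 1 - T ^ k) := by
    rw [Units.smul_mk0, smul_sub, smul_smul, mul_inv_cancel₀ hu0, one_smul]
  rw [this]
  exact (isUnit_smul_iff _ _).mpr hmem

theorem bddAbove_opNorm_resolvent {n : ℕ} {T : Matrix (Fin n) (Fin n) ℂ}
    (hT : ∀ u : ℂ, ‖u‖ ≤ 1 → IsUnit ((1 : Matrix (Fin n) (Fin n) ℂ) - u • T).det) :
    BddAbove {r : ℝ | ∃ z : ℂ, 1 ≤ ‖z‖ ∧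
      r = opNorm ((1 : Matrix (Fin n) (Fin n) ℂ) - z⁻¹ • T)⁻¹} := by
  have hlin : Continuous fun u : ℂ => (1 : Matrix (Fin n) (Fin n) ℂ) - u • T := by fun_prop
  have hcont : ContinuousOn
      (fun u : ℂ => opNorm ((1 : Matrix (Fin n) (Fin n) ℂ) - u • T)⁻¹)
      (Metric.closedBall 0 1) := by
    refine continuous_opNorm.comp_continuousOn ?_
    simp only [Matrix.inv_def, Ring.inverse_eq_inv']
    have hdet : ContinuousOn (fun u : ℂ => ((1 : Matrix (Fin n) (Fin n) ℂ) - u • T).det⁻¹)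
        (Metric.closedBall 0 1) :=
      hlin.matrix_det.continuousOn.inv₀ fun u hu => (hT u (by simpa using hu)).ne_zero
    exact hdet.smul hlin.matrix_adjugate.continuousOn
  refine ((isCompact_closedBall (0 : ℂ) 1).bddAbove_image hcont).mono ?_
  rintro r ⟨z, hz, rfl⟩
  exact ⟨z⁻¹, by simpa using inv_le_one_of_one_le₀ hz, rfl⟩

theorem opNorm_resolvent_le_sSB {n : ℕ} {T : Matrix (Fin n) (Fin n) ℂ}
    (hT : ∀ u : ℂ, ‖u‖ ≤ 1 → IsUnit ((1 : Matrix (Fin n) (Fin n) ℂ) - u • T).det)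
    {z : ℂ} (hz : 1 ≤ ‖z‖) :
    opNorm (z • (1 : Matrix (Fin n) (Fin n) ℂ) - T)⁻¹ ≤ sSB T := by
  have hz0 : z ≠ 0 := norm_pos_iff.mp (by linarith)
  have hle : ‖z⁻¹‖ ≤ 1 := by simpa using inv_le_one_of_one_le₀ hz
  have hu := hT z⁻¹ hle
  have hfac : z • (1 : Matrix (Fin n) (Fin n) ℂ) - T = (Units.mk0 z hz0) • (1 - z⁻¹ • T) := by
    rw [Units.smul_mk0, smul_sub, smul_smul, mul_inv_cancel₀ hz0, one_smul]
  have hinv : (z • (1 : Matrix (Fin n) (Fin n) ℂ) - T)⁻¹ = z⁻¹ • (1 - z⁻¹ • T)⁻¹ := by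
    rw [hfac, Matrix.inv_smul' _ _ hu]
    rfl
  rw [hinv, opNorm_smul]
  calc ‖z⁻¹‖ * opNorm (1 - z⁻¹ • T)⁻¹ ≤ 1 * opNorm (1 - z⁻¹ • T)⁻¹ :=
        mul_le_mul_of_nonneg_right hle (opNorm_nonneg _)
    _ ≤ sSB T := by
        rw [one_mul]
        exact le_csSup (bddAbove_opNorm_resolvent hT) ⟨z, hz, rfl⟩

theorem sSB_le_inv_one_sub {n : ℕ} {T : Matrix (Fin n) (Fin n) ℂ}
    (hT : ∀ u : ℂ, ‖u‖ ≤ 1 → IsUnit ((1 : Matrix (Fin n) (Fin n) ℂ) - u • T).det)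
    {c : ℝ} (hc : opNorm T ≤ c) (hc1 : c < 1) : sSB T ≤ (1 - c)⁻¹ := by
  refine csSup_le ⟨_, 1, by simp, rfl⟩ ?_
  rintro r ⟨z, hz, rfl⟩
  have hle : ‖z⁻¹‖ ≤ 1 := by simpa using inv_le_one_of_one_le₀ hz
  set N := ((1 : Matrix (Fin n) (Fin n) ℂ) - z⁻¹ • T)⁻¹ with hN
  have hmul : N = 1 + (z⁻¹ • T) * N := by
    have := Matrix.mul_nonsing_inv _ (hT z⁻¹ hle)
    rw [← hN, sub_mul, one_mul, sub_eq_iff_eq_add] at this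
    exact this
  have hzT : opNorm (z⁻¹ • T) ≤ c := by
    rw [opNorm_smul]
    nlinarith [opNorm_nonneg T]
  have h1 : opNorm N ≤ 1 + c * opNorm N := by
    calc opNorm N = opNorm (1 + (z⁻¹ • T) * N) := congrArg opNorm hmul
      _ ≤ opNorm (1 : Matrix (Fin n) (Fin n) ℂ) + opNorm ((z⁻¹ • T) * N) := opNorm_add_le _ _
      _ ≤ 1 + c * opNorm N := add_le_add opNorm_one_le ((opNorm_mul_le _ _).trans
          (mul_le_mul_of_nonneg_right hzT (opNorm_nonneg _)))
  rw [← one_div, le_div_iff₀ (by linarith)]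
  linarith

theorem sSB_nonneg {n : ℕ} (T : Matrix (Fin n) (Fin n) ℂ) : 0 ≤ sSB T := by
  refine Real.sSup_nonneg ?_
  rintro r ⟨z, _, rfl⟩
  exact opNorm_nonneg _

theorem opNorm_Tmat_le {n : ℕ} (B : Matrix (Fin n) (Fin n) ℝ) (k : ℕ) (hB : opNorm B < 1) :
    opNorm (Tmat B k) ≤ (1 - opNorm B ^ k) / (1 - opNorm B) := by
  rw [le_div_iff₀ (by linarith), ← geom_sum_mul_neg]
  refine mul_le_mul_of_nonneg_right ?_ (by linarith)
  exact (opNorm_sum_le _ _).trans (Finset.sum_le_sum fun j _ => opNorm_pow_le B j)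

theorem opNorm_Umat_le {m n : ℕ} (B : Matrix (Fin n) (Fin n) ℝ) (H : Matrix (Fin m) (Fin n) ℝ)
    (l : ℕ) : opNorm (Umat B H l) ≤ opNorm H ^ 2 * (l * opNorm B ^ (l - 1)) := by
  have hterm : ∀ i ∈ Finset.range l, opNorm ((Bᵀ) ^ i * (Hᵀ * H) * B ^ (l - 1 - i)) ≤
      opNorm H ^ 2 * opNorm B ^ (l - 1) := by
    intro i hi
    have hl : l - 1 = i + (l - 1 - i) := by have := Finset.mem_range.mp hi; omega
    have hBt : opNorm ((Bᵀ) ^ i) ≤ opNorm B ^ i := opNorm_transpose B ▸ opNorm_pow_le Bᵀ i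
    have hHH : opNorm (Hᵀ * H) ≤ opNorm H * opNorm H :=
      (opNorm_mul_le _ _).trans_eq (by rw [opNorm_transpose])
    have hb := opNorm_nonneg B
    calc _ ≤ opNorm ((Bᵀ) ^ i) * opNorm (Hᵀ * H) * opNorm (B ^ (l - 1 - i)) :=
          (opNorm_mul_le _ _).trans
            (mul_le_mul_of_nonneg_right (opNorm_mul_le _ _) (opNorm_nonneg _))
      _ ≤ opNorm B ^ i * (opNorm H * opNorm H) * opNorm B ^ (l - 1 - i) := by
          refine mul_le_mul (mul_le_mul hBt hHH (opNorm_nonneg _) (pow_nonneg hb _))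
            (opNorm_pow_le _ _) (opNorm_nonneg _) ?_
          exact mul_nonneg (pow_nonneg hb _) (mul_self_nonneg _)
      _ = opNorm H ^ 2 * opNorm B ^ (i + (l - 1 - i)) := by rw [pow_add]; ring
      _ = _ := by rw [← hl]
  refine (opNorm_sum_le _ _).trans ((Finset.sum_le_sum hterm).trans_eq ?_)
  rw [Finset.sum_const, Finset.card_range, nsmul_eq_mul]
  ring

theorem sum_Ico_mul_pow_pred_mul_sq (b : ℝ) {k : ℕ} (hk : 1 ≤ k) :
    (∑ l ∈ Finset.Ico 1 k, (l : ℝ) * b ^ (l - 1)) * (1 - b) ^ 2 =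
      1 - (k : ℝ) * b ^ (k - 1) + ((k : ℝ) - 1) * b ^ k := by
  induction k, hk using Nat.le_induction with
  | base => simp
  | succ k hk ih =>
    obtain ⟨j, rfl⟩ := Nat.exists_eq_add_of_le' hk
    rw [Finset.sum_Ico_succ_top hk, add_mul, ih]
    simp only [Nat.add_sub_cancel]
    push_cast
    ring

theorem opNorm_Xmat_le {m n : ℕ} (B : Matrix (Fin n) (Fin n) ℝ) (H : Matrix (Fin m) (Fin n) ℝ)
    {k : ℕ} (hk : 1 ≤ k) (hB : opNorm B < 1) :
    opNorm (Xmat B H k) ≤ opNorm H ^ 2 *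
      ((1 - (k : ℝ) * opNorm B ^ (k - 1) + ((k : ℝ) - 1) * opNorm B ^ k) /
        (1 - opNorm B) ^ 2) := by
  have h1 : (1 - opNorm B) ^ 2 ≠ 0 := pow_ne_zero _ (by linarith)
  rw [← sum_Ico_mul_pow_pred_mul_sq _ hk, mul_div_cancel_right₀ _ h1, Finset.mul_sum]
  exact (opNorm_sum_le _ _).trans (Finset.sum_le_sum fun l _ => opNorm_Umat_le B H l)

theorem ne_zero_of_quadratic_form_bounds {lam τ Y W x h a b m : ℝ} (hτ : 0 < τ) (hY : 0 < Y)
    (hW : 0 ≤ W) (ha : 0 ≤ a) (hb : 0 ≤ b) (hWY : W ≤ m * Y) (hx : |x| ≤ b * W) (hh : 0 ≤ h)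
    (hha : h ≤ a * W) (hbound : τ * ((a + 2 * b) * m) < 2) (hlam : lam ≠ 1) (hlam1 : 1 ≤ |lam|) :
    (lam - 1) * Y + τ * ((lam - 1) * x + h) ≠ 0 := by
  intro h0
  obtain ⟨hx1, hx2⟩ := abs_le.mp hx
  have hmain : τ * ((a + 2 * b) * W) < 2 * Y :=
    calc τ * ((a + 2 * b) * W) ≤ τ * ((a + 2 * b) * (m * Y)) := by gcongr
      _ = τ * ((a + 2 * b) * m) * Y := by ring
      _ < 2 * Y := by gcongr
  have hτh : 0 ≤ τ * h := mul_nonneg hτ.le hh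
  have hτx : -(τ * (b * W)) ≤ τ * x := by nlinarith
  have hτa : τ * h ≤ τ * (a * W) := by gcongr
  have hpos : 0 < 2 * Y + 2 * (τ * x) - τ * h := by nlinarith
  have hτaW : 0 ≤ τ * (a * W) := by positivity
  have hpos' : 0 < Y + τ * x := by nlinarith
  rcases le_abs'.mp hlam1 with hneg | hge
  · nlinarith
  · have hgt : 0 < lam - 1 := sub_pos.mpr (lt_of_le_of_ne hge (Ne.symm hlam))
    nlinarith [mul_pos hgt hpos']

/-- real eigenvalues for the shifted `k`-step one-shot method, `k ≥ 2`. -/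
theorem shifted_k_step_one_shot_real_eigenvalues
    (B : Matrix (Fin nu) (Fin nu) ℝ) (M : Matrix (Fin nu) (Fin nσ) ℝ)
    (H : Matrix (Fin nf) (Fin nu) ℝ)
    (hρ : ∀ μ ∈ spectrum ℂ (B.map Complex.ofReal), ‖μ‖ < 1)
    (k : ℕ) (hk : 2 ≤ k) :
    -- the eigenvalue-equation expression, for real λ and y ∈ ℂ^{nσ}
    let E : ℝ → (Fin nσ → ℂ) → ℝ → ℂ := fun lam y τ =>
      ((lam : ℂ) - 1) * (star y ⬝ᵥ y) +
        (τ : ℂ) * (star y ⬝ᵥ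
          (((M.map Complex.ofReal)ᵀ *
              ((lam : ℂ) • (1 : Matrix (Fin nu) (Fin nu) ℂ) - ((Bᵀ) ^ k).map Complex.ofReal)⁻¹ *
              (((lam : ℂ) - 1) • (Xmat B H k).map Complex.ofReal +
                ((Tmat B k)ᵀ * (Hᵀ * H) * Tmat B k).map Complex.ofReal) *
              ((lam : ℂ) • (1 : Matrix (Fin nu) (Fin nu) ℂ) - (B ^ k).map Complex.ofReal)⁻¹ *
              M.map Complex.ofReal) *ᵥ y))
    -- no real solution λ ≠ 1, |λ| ≥ 1, under the general bound on τ
    (∀ τ : ℝ, 0 < τ →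
      τ * (opNorm M ^ 2 * (opNorm H ^ 2 * opNorm (Tmat B k) ^ 2 + 2 * opNorm (Xmat B H k)) *
        sSB ((B ^ k).map Complex.ofReal) ^ 2) < 2 →
      ∀ lam : ℝ, lam ≠ 1 → 1 ≤ |lam| →
        ∀ y : Fin nσ → ℂ, y ≠ 0 → E lam y τ ≠ 0) ∧
    -- moreover, when ‖B‖ < 1 an explicit bound suffices
    (opNorm B < 1 →
      ∀ τ : ℝ, 0 < τ →
      τ < ((1 - opNorm B) ^ 2 / (opNorm H ^ 2 * opNorm M ^ 2)) *
        (2 * (1 - opNorm B ^ k) ^ 2 /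
          ((1 - opNorm B ^ k) ^ 2 +
            2 * (1 - (k : ℝ) * opNorm B ^ (k - 1) + ((k : ℝ) - 1) * opNorm B ^ k))) →
      ∀ lam : ℝ, lam ≠ 1 → 1 ≤ |lam| →
        ∀ y : Fin nσ → ℂ, y ≠ 0 → E lam y τ ≠ 0) := by
  intro E
  set P := (B ^ k).map Complex.ofReal with hP
  have hk0 : 0 < k := by omega
  have hunit : ∀ u : ℂ, ‖u‖ ≤ 1 → IsUnit ((1 : Matrix (Fin nu) (Fin nu) ℂ) - u • P).det := by
    intro u hu
    rw [hP, map_ofReal_pow]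
    exact isUnit_det_one_sub_smul_pow hρ hk0 hu
  have general : ∀ τ : ℝ, 0 < τ →
      τ * (opNorm M ^ 2 * (opNorm H ^ 2 * opNorm (Tmat B k) ^ 2 + 2 * opNorm (Xmat B H k)) *
        sSB P ^ 2) < 2 →
      ∀ lam : ℝ, lam ≠ 1 → 1 ≤ |lam| →
        ∀ y : Fin nσ → ℂ, y ≠ 0 → E lam y τ ≠ 0 := by
    intro τ hτ hbound lam hlam hlam1 y hy
    set R := ((lam : ℂ) • (1 : Matrix (Fin nu) (Fin nu) ℂ) - P)⁻¹ with hR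
    set Mc := M.map Complex.ofReal with hMc
    set Xc := (Xmat B H k).map Complex.ofReal with hXc
    set G := (H * Tmat B k).map Complex.ofReal with hG
    set w := (R * Mc) *ᵥ y with hw
    have hRH : ((lam : ℂ) • (1 : Matrix (Fin nu) (Fin nu) ℂ) -
        ((Bᵀ) ^ k).map Complex.ofReal)⁻¹ = Rᴴ := by
      rw [hR, Matrix.conjTranspose_nonsing_inv, Matrix.conjTranspose_sub,
        Matrix.conjTranspose_smul, Matrix.conjTranspose_one, hP, ← map_ofReal_transpose,
        Matrix.transpose_pow]
      simp
    have hMH : Mcᵀ = Mcᴴ := by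
      rw [hMc, ← map_ofReal_transpose, Matrix.transpose_map]
    have hGG : ((Tmat B k)ᵀ * (Hᵀ * H) * Tmat B k).map Complex.ofReal =
        Gᴴ * (1 : Matrix (Fin nf) (Fin nf) ℂ) * G := by
      rw [hG, ← map_ofReal_transpose, Matrix.mul_one, ← map_ofReal_mul, Matrix.transpose_mul]
      simp only [Matrix.mul_assoc]
    have hE : E lam y τ = ((lam : ℂ) - 1) * ((‖WithLp.toLp 2 y‖ ^ 2 : ℝ) : ℂ) +
        (τ : ℂ) * (((lam : ℂ) - 1) * (star w ⬝ᵥ (Xc *ᵥ w)) +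
          ((‖WithLp.toLp 2 (G *ᵥ w)‖ ^ 2 : ℝ) : ℂ)) := by
      have hprod (Q : Matrix (Fin nu) (Fin nu) ℂ) : Mcᵀ * Rᴴ * (((lam : ℂ) - 1) • Xc + Q) * R * Mc =
          (R * Mc)ᴴ * (((lam : ℂ) - 1) • Xc + Q) * (R * Mc) := by
        rw [hMH, Matrix.conjTranspose_mul]
        simp only [Matrix.mul_assoc]
      simp only [E]
      rw [hRH, hGG, hprod, star_dotProduct_conjTranspose_mul_mul_mulVec, ← hw, Matrix.add_mulVec,
        dotProduct_add, Matrix.smul_mulVec, dotProduct_smul, smul_eq_mul,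
        star_dotProduct_conjTranspose_mul_mul_mulVec, Matrix.one_mulVec,
        star_dotProduct_self_eq_norm_sq, star_dotProduct_self_eq_norm_sq]
    have hEre : (E lam y τ).re = (lam - 1) * ‖WithLp.toLp 2 y‖ ^ 2 +
        τ * ((lam - 1) * (star w ⬝ᵥ (Xc *ᵥ w)).re + ‖WithLp.toLp 2 (G *ᵥ w)‖ ^ 2) := by
      have hcast : (lam : ℂ) - 1 = ((lam - 1 : ℝ) : ℂ) := by push_cast; ring
      rw [hE, hcast]
      simp only [Complex.add_re, Complex.re_ofReal_mul, Complex.ofReal_re]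
    intro h0
    have hwnorm : ‖WithLp.toLp 2 w‖ ≤ sSB P * opNorm M * ‖WithLp.toLp 2 y‖ := by
      refine (norm_toLp_mulVec_le_opNorm _ _).trans ?_
      refine mul_le_mul_of_nonneg_right ((opNorm_mul_le _ _).trans ?_) (norm_nonneg _)
      exact mul_le_mul (opNorm_resolvent_le_sSB hunit (by simpa using hlam1))
        (opNorm_map_ofReal_le M) (opNorm_nonneg _) (sSB_nonneg _)
    have hGnorm : ‖WithLp.toLp 2 (G *ᵥ w)‖ ≤
        opNorm H * opNorm (Tmat B k) * ‖WithLp.toLp 2 w‖ :=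
      (norm_toLp_mulVec_le_opNorm _ _).trans (mul_le_mul_of_nonneg_right
        ((opNorm_map_ofReal_le _).trans (opNorm_mul_le _ _)) (norm_nonneg _))
    have hypos : 0 < ‖WithLp.toLp 2 y‖ := by
      rw [norm_pos_iff]
      simpa using hy
    refine ne_zero_of_quadratic_form_bounds (a := opNorm H ^ 2 * opNorm (Tmat B k) ^ 2)
      (b := opNorm (Xmat B H k)) (m := opNorm M ^ 2 * sSB P ^ 2) (W := ‖WithLp.toLp 2 w‖ ^ 2)
      hτ (pow_pos hypos 2) (sq_nonneg _) (by positivity) (opNorm_nonneg _) ?_ ?_ (sq_nonneg _) ?_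
      ?_ hlam hlam1 (hEre.symm.trans (by rw [h0, Complex.zero_re]))
    · calc ‖WithLp.toLp 2 w‖ ^ 2 ≤ (sSB P * opNorm M * ‖WithLp.toLp 2 y‖) ^ 2 := by gcongr
        _ = _ := by ring
    · exact (abs_re_star_dotProduct_mulVec_le Xc w).trans
        (mul_le_mul_of_nonneg_right (opNorm_map_ofReal_le _) (sq_nonneg _))
    · calc ‖WithLp.toLp 2 (G *ᵥ w)‖ ^ 2 ≤
            (opNorm H * opNorm (Tmat B k) * ‖WithLp.toLp 2 w‖) ^ 2 := by gcongr
        _ = _ := by ring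
    · calc _ = _ := by ring
        _ < 2 := hbound
  refine ⟨general, fun hB τ hτ hτlt => general τ hτ ?_⟩
  have hb := opNorm_nonneg B
  have hT := opNorm_Tmat_le B k hB
  have hX := opNorm_Xmat_le B H hk0 hB
  have hbk : opNorm B ^ k < 1 := pow_lt_one₀ hb hB hk0.ne'
  have hS : sSB P ≤ (1 - opNorm B ^ k)⁻¹ :=
    sSB_le_inv_one_sub hunit ((opNorm_map_ofReal_le _).trans (opNorm_pow_le B k)) hbk
  have hq : 0 ≤ 1 - (k : ℝ) * opNorm B ^ (k - 1) + ((k : ℝ) - 1) * opNorm B ^ k := by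
    rw [← sum_Ico_mul_pow_pred_mul_sq _ hk0]
    exact mul_nonneg (Finset.sum_nonneg fun l _ => by positivity) (sq_nonneg _)
  set q := 1 - (k : ℝ) * opNorm B ^ (k - 1) + ((k : ℝ) - 1) * opNorm B ^ k with hqdef
  have hHM : 0 < opNorm H ^ 2 * opNorm M ^ 2 := by
    refine lt_of_le_of_ne (by positivity) fun h0 => ?_
    rw [← h0, div_zero, zero_mul] at hτlt
    linarith
  have hc : 0 < 1 - opNorm B := by linarith
  have hd : 0 < 1 - opNorm B ^ k := by linarith
  have hT0 := opNorm_nonneg (Tmat B k)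
  have hX0 := opNorm_nonneg (Xmat B H k)
  have hS0 := sSB_nonneg P
  calc τ * (opNorm M ^ 2 * (opNorm H ^ 2 * opNorm (Tmat B k) ^ 2 + 2 * opNorm (Xmat B H k)) *
        sSB P ^ 2)
      ≤ τ * (opNorm M ^ 2 * (opNorm H ^ 2 * ((1 - opNorm B ^ k) / (1 - opNorm B)) ^ 2 +
        2 * (opNorm H ^ 2 * (q / (1 - opNorm B) ^ 2))) * (1 - opNorm B ^ k)⁻¹ ^ 2) := by
        gcongr
    _ = τ * ((opNorm H ^ 2 * opNorm M ^ 2) * ((1 - opNorm B ^ k) ^ 2 + 2 * q) /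
        ((1 - opNorm B) ^ 2 * (1 - opNorm B ^ k) ^ 2)) := by
        field_simp
    _ < ((1 - opNorm B) ^ 2 / (opNorm H ^ 2 * opNorm M ^ 2)) *
        (2 * (1 - opNorm B ^ k) ^ 2 / ((1 - opNorm B ^ k) ^ 2 + 2 * q)) *
        ((opNorm H ^ 2 * opNorm M ^ 2) * ((1 - opNorm B ^ k) ^ 2 + 2 * q) /
        ((1 - opNorm B) ^ 2 * (1 - opNorm B ^ k) ^ 2)) :=
        mul_lt_mul_of_pos_right hτlt (by positivity)
    _ = 2 := by
        have hH0 : opNorm H ≠ 0 := fun h => by simp [h] at hHM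
        have hM0 : opNorm M ≠ 0 := fun h => by simp [h] at hHM
        have hden : (1 - opNorm B ^ k) ^ 2 + 2 * q ≠ 0 := by positivity
        field_simp
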